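/- arXiv:2603.22714 — 4 statements merged into one kernel-verified Lean document; each statement's English description precedes it below -/
import Mathlib

section
/- For every function h : ℛ × 𝒳 × 𝒵 → ℝ, Σ_{r,x,z} π²(r,x,z) · h(r,x,z) · P(r,x,z) = Σ_{r,z} h(r,x₁,z) · P(r|x₀,z) · P(z), where π²(r,x,z) = (P(x₀|r,z)/P(x|r,z)) · (1[x = x₁]/P(x₀|z)). -/
open Finset

noncomputable section

variable {𝒳 𝒵 ℬ ℛ : Type*} [Fintype 𝒳] [Fintype 𝒵] [Fintype ℬ] [Fintype ℛ]

/-- Marginal `P(z)`. -/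
def Pz (p : 𝒳 → 𝒵 → ℬ → ℛ → ℝ) (z : 𝒵) : ℝ := ∑ x, ∑ b, ∑ r, p x z b r

/-- Marginal `P(x,z)`. -/
def Pxz (p : 𝒳 → 𝒵 → ℬ → ℛ → ℝ) (x : 𝒳) (z : 𝒵) : ℝ := ∑ b, ∑ r, p x z b r

/-- Marginal `P(r,z)`. -/
def Prz (p : 𝒳 → 𝒵 → ℬ → ℛ → ℝ) (r : ℛ) (z : 𝒵) : ℝ := ∑ x, ∑ b, p x z b r

/-- Marginal `P(x,r,z)`. -/
def Pxrz (p : 𝒳 → 𝒵 → ℬ → ℛ → ℝ) (x : 𝒳) (r : ℛ) (z : 𝒵) : ℝ := ∑ b, p x z b r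

/-- Conditional `P(x|z)`. -/
def PxGz (p : 𝒳 → 𝒵 → ℬ → ℛ → ℝ) (x : 𝒳) (z : 𝒵) : ℝ := Pxz p x z / Pz p z

/-- Conditional `P(r|x,z)`. -/
def PrGxz (p : 𝒳 → 𝒵 → ℬ → ℛ → ℝ) (r : ℛ) (x : 𝒳) (z : 𝒵) : ℝ :=
  Pxrz p x r z / Pxz p x z

/-- Conditional `P(x|r,z)`. -/
def PxGrz (p : 𝒳 → 𝒵 → ℬ → ℛ → ℝ) (x : 𝒳) (r : ℛ) (z : 𝒵) : ℝ :=
  Pxrz p x r z / Prz p r z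

/-- Conditional `P(b|x,r,z)`. -/
def PbGxrz (p : 𝒳 → 𝒵 → ℬ → ℛ → ℝ) (b : ℬ) (x : 𝒳) (r : ℛ) (z : 𝒵) : ℝ :=
  p x z b r / Pxrz p x r z

/-- the `π²`-weighted mean of any `h` equals the corresponding
path-specific functional. -/
theorem pi2_weighting
    [Nonempty 𝒳] [Nonempty 𝒵] [Nonempty ℬ] [Nonempty ℛ] [DecidableEq 𝒳]
    (p : 𝒳 → 𝒵 → ℬ → ℛ → ℝ)
    (hpos : ∀ x z b r, 0 < p x z b r)
    (hsum : ∑ x, ∑ z, ∑ b, ∑ r, p x z b r = 1)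
    (x₀ x₁ : 𝒳)
    (h : ℛ × 𝒳 × 𝒵 → ℝ) :
    ∑ r, ∑ x, ∑ z,
        ((PxGrz p x₀ r z / PxGrz p x r z)
            * ((if x = x₁ then (1 : ℝ) else 0) / PxGz p x₀ z))
          * h (r, x, z) * Pxrz p x r z
      = ∑ r, ∑ z, h (r, x₁, z) * PrGxz p r x₀ z * Pz p z := by
  refine Finset.sum_congr rfl fun r _ => ?_
  rw [Finset.sum_eq_single x₁]
  · refine Finset.sum_congr rfl fun z _ => ?_
    have h1 : ∀ x, 0 < Pxrz p x r z := fun x =>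
      Finset.sum_pos (fun b _ => hpos x z b r) Finset.univ_nonempty
    have h2 : 0 < Prz p r z :=
      Finset.sum_pos (fun x _ => h1 x) Finset.univ_nonempty
    have h3 : ∀ x, 0 < Pxz p x z := fun x =>
      Finset.sum_pos (fun b _ => Finset.sum_pos (fun r _ => hpos x z b r)
        Finset.univ_nonempty) Finset.univ_nonempty
    have h4 : 0 < Pz p z :=
      Finset.sum_pos (fun x _ => h3 x) Finset.univ_nonempty
    have a1 := (h1 x₁).ne'
    have a2 := h2.ne'
    have a3 := (h3 x₀).ne'
    have a4 := h4.ne'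
    simp only [PxGrz, PxGz, PrGxz, if_true]
    field_simp
  · intro x _ hx
    simp [hx]
  · intro hx
    exact absurd (Finset.mem_univ _) hx
end
end

section
/- For every function h : ℬ × ℛ × 𝒳 × 𝒵 → ℝ, Σ_{x,z,b,r} π³(b,r,x,z) · h(b,r,x,z) · p(x,z,b,r) = Σ_{b,r,z} h(b,r,x₁,z) · P(b|x₁,r,z) · P(r|x₀,z) · P(z), where π³(b,r,x,z) = (P(x₀|r,z)/P(x|r,z)) · (1[x = x₁]/P(x₀|z)) (a function not depending on b). -/
open Finset

noncomputable section

variable {𝒳 𝒵 ℬ ℛ : Type*} [Fintype 𝒳] [Fintype 𝒵] [Fintype ℬ] [Fintype ℛ]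

/-- the `π³`-weighted mean of any `h` equals the corresponding
path-specific functional. -/
theorem pi3_weighting
    [Nonempty 𝒳] [Nonempty 𝒵] [Nonempty ℬ] [Nonempty ℛ] [DecidableEq 𝒳]
    (p : 𝒳 → 𝒵 → ℬ → ℛ → ℝ)
    (hpos : ∀ x z b r, 0 < p x z b r)
    (hsum : ∑ x, ∑ z, ∑ b, ∑ r, p x z b r = 1)
    (x₀ x₁ : 𝒳)
    (h : ℬ × ℛ × 𝒳 × 𝒵 → ℝ) :
    ∑ x, ∑ z, ∑ b, ∑ r,
        ((PxGrz p x₀ r z / PxGrz p x r z)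
            * ((if x = x₁ then (1 : ℝ) else 0) / PxGz p x₀ z))
          * h (b, r, x, z) * p x z b r
      = ∑ b, ∑ r, ∑ z,
          h (b, r, x₁, z) * PbGxrz p b x₁ r z * PrGxz p r x₀ z * Pz p z := by
  have hPz : ∀ z, Pz p z ≠ 0 := fun z => ne_of_gt <|
    Finset.sum_pos (fun x _ => Finset.sum_pos (fun b _ => Finset.sum_pos
      (fun r _ => hpos x z b r) Finset.univ_nonempty) Finset.univ_nonempty) Finset.univ_nonempty
  have hPxz : ∀ x z, Pxz p x z ≠ 0 := fun x z => ne_of_gt <|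
    Finset.sum_pos (fun b _ => Finset.sum_pos
      (fun r _ => hpos x z b r) Finset.univ_nonempty) Finset.univ_nonempty
  have hPrz : ∀ r z, Prz p r z ≠ 0 := fun r z => ne_of_gt <|
    Finset.sum_pos (fun x _ => Finset.sum_pos
      (fun b _ => hpos x z b r) Finset.univ_nonempty) Finset.univ_nonempty
  have hPxrz : ∀ x r z, Pxrz p x r z ≠ 0 := fun x r z => ne_of_gt <|
    Finset.sum_pos (fun b _ => hpos x z b r) Finset.univ_nonempty
  rw [Finset.sum_eq_single x₁ (fun x _ hx => by simp [hx]) (by simp)]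
  rw [Finset.sum_comm]
  refine Finset.sum_congr rfl fun b _ => ?_
  rw [Finset.sum_comm]
  refine Finset.sum_congr rfl fun r _ => Finset.sum_congr rfl fun z _ => ?_
  have h1 := hPz z
  have h2 := hPxz x₀ z
  have h3 := hPrz r z
  have h4 := hPxrz x₁ r z
  simp only [PxGrz, PxGz, PbGxrz, PrGxz, if_true]
  field_simp
end
end

section
/- Let m : 𝒳 × ℬ × ℛ × 𝒵 → ℝ be any function and define μ²(r,x,z) = Σ_b m(x₁,b,r,z) · P(b|x,r,z). Then Σ_{r,x,z} π²(r,x,z) · μ²(r,x,z) · P(r,x,z) = ψ, where π²(r,x,z) = (P(x₀|r,z)/P(x|r,z)) · (1[x = x₁]/P(x₀|z)) and ψ = Σ_{b,r,z} m(x₁,b,r,z) · P(b|x₁,r,z) · P(r|x₀,z) · P(z). That is, the π²-weighted mean of the first-stage regression μ² equals the identified path-specific functional ψ. -/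
open Finset

noncomputable section

variable {𝒳 𝒵 ℬ ℛ : Type*} [Fintype 𝒳] [Fintype 𝒵] [Fintype ℬ] [Fintype ℛ]

/-- the `π²`-weighted mean of the first-stage regression `μ²`
equals the identified path-specific functional `ψ`. -/
theorem pi2_weighted_first_stage
    [Nonempty 𝒳] [Nonempty 𝒵] [Nonempty ℬ] [Nonempty ℛ] [DecidableEq 𝒳]
    (p : 𝒳 → 𝒵 → ℬ → ℛ → ℝ)
    (hpos : ∀ x z b r, 0 < p x z b r)
    (hsum : ∑ x, ∑ z, ∑ b, ∑ r, p x z b r = 1)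
    (x₀ x₁ : 𝒳)
    (m : 𝒳 × ℬ × ℛ × 𝒵 → ℝ) :
    ∑ r, ∑ x, ∑ z,
        ((PxGrz p x₀ r z / PxGrz p x r z)
            * ((if x = x₁ then (1 : ℝ) else 0) / PxGz p x₀ z))
          * (∑ b, m (x₁, b, r, z) * PbGxrz p b x r z) * Pxrz p x r z
      = ∑ b, ∑ r, ∑ z,
          m (x₁, b, r, z) * PbGxrz p b x₁ r z * PrGxz p r x₀ z * Pz p z := by
  have hx : ∀ x r z, 0 < Pxrz p x r z := fun x r z =>
    Finset.sum_pos (fun b _ => hpos x z b r) Finset.univ_nonempty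
  have hr : ∀ r z, 0 < Prz p r z := fun r z =>
    Finset.sum_pos (fun x _ => hx x r z) Finset.univ_nonempty
  have hxz : ∀ x z, 0 < Pxz p x z := fun x z =>
    Finset.sum_pos (fun b _ => Finset.sum_pos (fun r _ => hpos x z b r)
      Finset.univ_nonempty) Finset.univ_nonempty
  have hz : ∀ z, 0 < Pz p z := fun z =>
    Finset.sum_pos (fun x _ => hxz x z) Finset.univ_nonempty
  rw [Finset.sum_comm (s := (Finset.univ : Finset ℬ))]
  refine Finset.sum_congr rfl fun r _ => ?_
  rw [Finset.sum_eq_single x₁ (fun x _ hne => by simp [hne]) (by simp)]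
  rw [Finset.sum_comm (s := (Finset.univ : Finset ℬ))]
  refine Finset.sum_congr rfl fun z _ => ?_
  rw [Finset.mul_sum, Finset.sum_mul]
  refine Finset.sum_congr rfl fun b _ => ?_
  have h1 := (hx x₀ r z).ne'
  have h2 := (hx x₁ r z).ne'
  have h3 := (hr r z).ne'
  have h4 := (hxz x₀ z).ne'
  have h5 := (hz z).ne'
  simp only [PxGrz, PxGz, PrGxz, PbGxrz, if_true]
  field_simp
end
end

section
/- Let ĥ : ℛ × 𝒳 × 𝒵 → ℝ be an arbitrary function and define ĥ₁(x,z) = Σ_r ĥ(r,x₁,z) · P(r|x,z). Then Σ_{r,x,z} π²(r,x,z) · ĥ(r,x,z) · P(r,x,z) = Σ_{x,z} π¹(x,z) · ĥ₁(x,z) · P(x,z), where π²(r,x,z) = (P(x₀|r,z)/P(x|r,z)) · (1[x = x₁]/P(x₀|z)) and π¹(x,z) = 1[x = x₀]/P(x|z). That is, the second key equality underlying the doubly robust property holds for any fixed, possibly misspecified, second-stage regression ĥ. -/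
open Finset

noncomputable section

variable {𝒳 𝒵 ℬ ℛ : Type*} [Fintype 𝒳] [Fintype 𝒵] [Fintype ℬ] [Fintype ℛ]

/-- second key equality underlying the doubly robust property,
for an arbitrary (possibly misspecified) second-stage regression `hhat`. -/
theorem doubly_robust_second_equality
    [Nonempty 𝒳] [Nonempty 𝒵] [Nonempty ℬ] [Nonempty ℛ] [DecidableEq 𝒳]
    (p : 𝒳 → 𝒵 → ℬ → ℛ → ℝ)
    (hpos : ∀ x z b r, 0 < p x z b r)
    (hsum : ∑ x, ∑ z, ∑ b, ∑ r, p x z b r = 1)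
    (x₀ x₁ : 𝒳)
    (hhat : ℛ × 𝒳 × 𝒵 → ℝ) :
    ∑ r, ∑ x, ∑ z,
        ((PxGrz p x₀ r z / PxGrz p x r z)
            * ((if x = x₁ then (1 : ℝ) else 0) / PxGz p x₀ z))
          * hhat (r, x, z) * Pxrz p x r z
      = ∑ x, ∑ z,
          ((if x = x₀ then (1 : ℝ) else 0) / PxGz p x z)
            * (∑ r, hhat (r, x₁, z) * PrGxz p r x z) * Pxz p x z := by
  have hx : ∀ x r z, Pxrz p x r z ≠ 0 := fun x r z =>
    (Finset.sum_pos (fun b _ => hpos x z b r) Finset.univ_nonempty).ne'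
  have hr : ∀ r z, Prz p r z ≠ 0 := fun r z =>
    (Finset.sum_pos (fun x _ => Finset.sum_pos (fun b _ => hpos x z b r)
      Finset.univ_nonempty) Finset.univ_nonempty).ne'
  have hxz : ∀ x z, Pxz p x z ≠ 0 := fun x z =>
    (Finset.sum_pos (fun b _ => Finset.sum_pos (fun r _ => hpos x z b r)
      Finset.univ_nonempty) Finset.univ_nonempty).ne'
  have hL : ∀ r, (∑ x, ∑ z,
        ((PxGrz p x₀ r z / PxGrz p x r z)
            * ((if x = x₁ then (1 : ℝ) else 0) / PxGz p x₀ z))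
          * hhat (r, x, z) * Pxrz p x r z)
      = ∑ z, Pxrz p x₀ r z / PxGz p x₀ z * hhat (r, x₁, z) := by
    intro r
    rw [Finset.sum_eq_single x₁]
    · refine Finset.sum_congr rfl fun z _ => ?_
      have h1 := hx x₁ r z
      have h2 := hr r z
      rw [if_pos rfl]
      unfold PxGrz
      generalize PxGz p x₀ z = c
      have h3 : Pxrz p x₀ r z / Prz p r z / (Pxrz p x₁ r z / Prz p r z)
          = Pxrz p x₀ r z / Pxrz p x₁ r z := div_div_div_cancel_right₀ h2 _ _
      rw [h3, one_div, div_eq_mul_inv, div_eq_mul_inv]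
      have h4 : (Pxrz p x₁ r z)⁻¹ * Pxrz p x₁ r z = 1 := inv_mul_cancel₀ h1
      linear_combination (Pxrz p x₀ r z * c⁻¹ * hhat (r, x₁, z)) * h4
    · intro x _ hne
      simp [hne]
    · simp
  rw [Finset.sum_congr rfl fun r _ => hL r, Finset.sum_comm, Finset.sum_eq_single x₀]
  · refine Finset.sum_congr rfl fun z _ => ?_
    rw [if_pos rfl, Finset.mul_sum, Finset.sum_mul]
    refine Finset.sum_congr rfl fun r _ => ?_
    have h1 := hxz x₀ z
    unfold PrGxz
    generalize PxGz p x₀ z = c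
    have h4 : (Pxz p x₀ z)⁻¹ * Pxz p x₀ z = 1 := inv_mul_cancel₀ h1
    rw [one_div, div_eq_mul_inv, div_eq_mul_inv]
    linear_combination (-(Pxrz p x₀ r z * c⁻¹ * hhat (r, x₁, z))) * h4
  · intro x _ hne
    simp [hne]
  · simp
end
end
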